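/- If a prime ℓ and a Galois number field K satisfy gcd(ℓ, disc(K)) = 1, then the ring of integers of K(ζ_ℓ) equals O_K[ζ_ℓ], i.e. the powers 1, ζ_ℓ, ..., ζ_ℓ^{ℓ-2} form a relative integral basis of K(ζ_ℓ)/K. -/

import Mathlib

open NumberField in
/-- The discriminant of the `ℓ`-th cyclotomic field, `ℓ` prime, is coprime to every integer
coprime to `ℓ`. -/
theorem isCoprime_discr_of_isCyclotomicExtension_prime (F : Type*) [Field F] [NumberField F]
    {ℓ : ℕ} (hℓ : ℓ.Prime) [IsCyclotomicExtension {ℓ} ℚ F] {d : ℤ} (h : IsCoprime (ℓ : ℤ) d) :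
    IsCoprime d (discr F) := by
  have : NeZero ℓ := ⟨hℓ.ne_zero⟩
  rw [Int.isCoprime_iff_nat_coprime, IsCyclotomicExtension.Rat.natAbs_discr ℓ F]
  refine Nat.Coprime.coprime_div_right ?_ (Nat.prod_primeFactors_pow_totient_ediv_dvd hℓ.pos)
  exact Nat.Coprime.pow_right _ (by simpa using Int.isCoprime_iff_nat_coprime.mp h.symm)

open NumberField in
/-- An element of `𝓞 L` lying in the image of `K` comes from `𝓞 K`. -/
theorem NumberField.RingOfIntegers.algebraMap_fieldRange_mem_range (K L : Type*) [Field K] [Field L]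
    [NumberField K] [NumberField L] [Algebra K L]
    (y : 𝓞 (IsScalarTower.toAlgHom ℚ K L).fieldRange) :
    algebraMap _ (𝓞 L) y ∈ (algebraMap (𝓞 K) (𝓞 L)).range := by
  obtain ⟨x, hx⟩ := (y : (IsScalarTower.toAlgHom ℚ K L).fieldRange).2
  have hxL : algebraMap K L x = algebraMap (𝓞 L) L (algebraMap _ (𝓞 L) y) := hx
  have hint : IsIntegral ℤ x := by
    rw [← isIntegral_algebraMap_iff (algebraMap K L).injective, hxL]
    exact RingOfIntegers.isIntegral_coe _
  refine ⟨⟨x, hint⟩, RingOfIntegers.ext hxL⟩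

open NumberField IntermediateField in
/-- If a prime ℓ and a Galois number field K satisfy gcd(ℓ, disc K) = 1,
then the ring of integers of K(ζ_ℓ) equals O_K[ζ_ℓ]. -/
theorem stmt_0 (K L : Type*) [Field K] [Field L] [NumberField K] [NumberField L]
    [Algebra K L] (ℓ : ℕ) (hℓ : ℓ.Prime)
    (hGal : IsGalois ℚ K)
    (hcop : IsCoprime (ℓ : ℤ) (NumberField.discr K))
    (ζ : NumberField.RingOfIntegers L)
    (hζ : IsPrimitiveRoot (algebraMap (NumberField.RingOfIntegers L) L ζ) ℓ)
    (hgen : Algebra.adjoin K {algebraMap (NumberField.RingOfIntegers L) L ζ} = ⊤) :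
    Algebra.adjoin (NumberField.RingOfIntegers K) {ζ} = ⊤ := by
  have : NeZero ℓ := ⟨hℓ.ne_zero⟩
  set z : L := algebraMap (𝓞 L) L ζ
  let F₁ : IntermediateField ℚ L := (IsScalarTower.toAlgHom ℚ K L).fieldRange
  let F₂ : IntermediateField ℚ L := ℚ⟮z⟯
  let e : K ≃ₐ[ℚ] F₁ := AlgEquiv.ofInjectiveField (IsScalarTower.toAlgHom ℚ K L)
  have : IsGalois ℚ F₁ := IsGalois.of_algEquiv e
  have : IsCyclotomicExtension {ℓ} ℚ F₂ := hζ.intermediateField_adjoin_isCyclotomicExtension ℚ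
  have hζ₂ : IsPrimitiveRoot (AdjoinSimple.gen ℚ z) ℓ :=
    IsPrimitiveRoot.coe_submonoidClass_iff.mp hζ
  have h_cpr : IsCoprime (discr F₁) (discr F₂) := by
    rw [← discr_eq_discr_of_algEquiv K e]
    exact isCoprime_discr_of_isCyclotomicExtension_prime F₂ hℓ hcop
  have h_disj : F₁.LinearDisjoint F₂ := linearDisjoint_of_isGalois_isCoprime_discr L F₁ F₂ h_cpr
  have h_sup : F₁.toSubalgebra ⊔ F₂.toSubalgebra = ⊤ := by
    refine Algebra.eq_top_iff.mpr fun x ↦ ?_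
    have hx : x ∈ Algebra.adjoin K {z} := hgen ▸ Algebra.mem_top
    induction hx using Algebra.adjoin_induction with
    | mem x hx =>
      rw [Set.mem_singleton_iff.mp hx]
      exact Algebra.mem_sup_right (mem_adjoin_simple_self ℚ z)
    | algebraMap r => exact Algebra.mem_sup_left ⟨r, rfl⟩
    | add x y _ _ hx hy => exact add_mem hx hy
    | mul x y _ _ hx hy => exact mul_mem hx hy
  have h_top := IsDedekindDomain.range_sup_range_eq_top_of_isCoprime_differentIdeal
    ℤ (𝓞 L) (𝓞 F₁) (𝓞 F₂) h_disj h_sup (isCoprime_differentIdeal_of_isCoprime_discr L h_cpr)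
  suffices h : (⊤ : Subalgebra ℤ (𝓞 L)) ≤ (Algebra.adjoin (𝓞 K) {ζ}).restrictScalars ℤ from
    Algebra.eq_top_iff.mpr fun x ↦ h Algebra.mem_top
  rw [← h_top]
  refine sup_le ?_ ?_
  · rintro _ ⟨y, rfl⟩
    obtain ⟨x, hx⟩ := NumberField.RingOfIntegers.algebraMap_fieldRange_mem_range K L y
    have h : algebraMap (𝓞 F₁) (𝓞 L) y ∈ Algebra.adjoin (𝓞 K) {ζ} := by
      rw [← hx]
      exact Subalgebra.algebraMap_mem _ x
    exact h
  · have h : algebraMap (𝓞 F₂) (𝓞 L) hζ₂.toInteger = ζ := RingOfIntegers.ext rfl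
    rw [← Algebra.map_top, ← IsCyclotomicExtension.Rat.adjoin_singleton_eq_top hζ₂,
      AlgHom.map_adjoin_singleton, Algebra.adjoin_le_iff, Set.singleton_subset_iff,
      IsScalarTower.coe_toAlgHom', h]
    exact Algebra.self_mem_adjoin_singleton (𝓞 K) ζ
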